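/- Let C be a category such that hom_C extends to monoids, i.e. there is a functor map: C^op × C → Mon with hom(A,B) ⊆ U map(A,B) naturally in A, B (U the forgetful functor). Given any functor K: C^op × C → Mon and any natural transformation D: K → map, define H(A,B) = {(x,f) ∈ UK(A,B) × hom(A,B) | D(x) + f ∈ hom(A,B)} and H(h,g)(x,f) = (gxh, gfh). Then H, with 2-cells (x,f): f → D(x)+f, vertical composition (x', D(x)+f) + (x,f) = (x'+x, f), identities (0,f), and actions g(x,f)h = (gxh, gfh), is a 2-cell structure on C. If in addition D(y)x + gx + yf = yD(x) + yf + gx for all (x,f) ∈ H(A,B) and (y,g) ∈ H(B,C), then the resulting structure is a 2-category. -/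

import Mathlib

open CategoryTheory Opposite

universe v u

/- elementary side (framework) -/
structure TwoCellData (C : Type u) [Category.{v} C] where
  H : C → C → Type v
  dm : ∀ {A B : C}, H A B → (A ⟶ B)
  cd : ∀ {A B : C}, H A B → (A ⟶ B)
  zero : ∀ {A B : C}, (A ⟶ B) → H A B
  add : ∀ {A B : C} (x x' : H A B), dm x = cd x' → H A B
  actL : ∀ {A B B' : C}, (B ⟶ B') → H A B → H A B'
  actR : ∀ {A' A B : C}, H A B → (A' ⟶ A) → H A' B

namespace TwoCellData
variable {C : Type u} [Category.{v} C]
structure Lawful (S : TwoCellData C) : Prop where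
  dm_actL : ∀ {A B B' : C} (g : B ⟶ B') (y : S.H A B), S.dm (S.actL g y) = S.dm y ≫ g
  dm_actR : ∀ {A' A B : C} (x : S.H A B) (f : A' ⟶ A), S.dm (S.actR x f) = f ≫ S.dm x
  cd_actL : ∀ {A B B' : C} (g : B ⟶ B') (y : S.H A B), S.cd (S.actL g y) = S.cd y ≫ g
  cd_actR : ∀ {A' A B : C} (x : S.H A B) (f : A' ⟶ A), S.cd (S.actR x f) = f ≫ S.cd x
  actL_zero : ∀ {A B B' : C} (g : B ⟶ B') (f : A ⟶ B), S.actL g (S.zero f) = S.zero (f ≫ g)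
  actR_zero : ∀ {A' A B : C} (f : A ⟶ B) (h : A' ⟶ A), S.actR (S.zero f) h = S.zero (h ≫ f)
  actR_add : ∀ {A' A B : C} (x x' : S.H A B) (h : S.dm x = S.cd x') (f : A' ⟶ A)
      (h2 : S.dm (S.actR x f) = S.cd (S.actR x' f)),
      S.actR (S.add x x' h) f = S.add (S.actR x f) (S.actR x' f) h2
  actL_add : ∀ {A B B' : C} (y y' : S.H A B) (h : S.dm y = S.cd y') (g : B ⟶ B')
      (h2 : S.dm (S.actL g y) = S.cd (S.actL g y')),
      S.actL g (S.add y y' h) = S.add (S.actL g y) (S.actL g y') h2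
  actL_actL : ∀ {A B B' B'' : C} (g : B ⟶ B') (g' : B' ⟶ B'') (y : S.H A B),
      S.actL g' (S.actL g y) = S.actL (g ≫ g') y
  actR_actR : ∀ {A'' A' A B : C} (x : S.H A B) (f : A' ⟶ A) (f' : A'' ⟶ A'),
      S.actR (S.actR x f) f' = S.actR x (f' ≫ f)
  actL_actR : ∀ {A' A B B' : C} (g : B ⟶ B') (x : S.H A B) (f : A' ⟶ A),
      S.actL g (S.actR x f) = S.actR (S.actL g x) f
  actL_id : ∀ {A B : C} (x : S.H A B), S.actL (𝟙 B) x = x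
  actR_id : ∀ {A B : C} (x : S.H A B), S.actR x (𝟙 A) = x
  dm_zero : ∀ {A B : C} (f : A ⟶ B), S.dm (S.zero f) = f
  cd_zero : ∀ {A B : C} (f : A ⟶ B), S.cd (S.zero f) = f
  dm_add : ∀ {A B : C} (x x' : S.H A B) (h), S.dm (S.add x x' h) = S.dm x'
  cd_add : ∀ {A B : C} (x x' : S.H A B) (h), S.cd (S.add x x' h) = S.cd x
  zero_add : ∀ {A B : C} (x : S.H A B) (h), S.add (S.zero (S.cd x)) x h = x
  add_zero : ∀ {A B : C} (x : S.H A B) (h), S.add x (S.zero (S.dm x)) h = x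
  add_assoc : ∀ {A B : C} (x x' x'' : S.H A B) (h1 : S.dm x = S.cd x')
      (h2 : S.dm x' = S.cd x'') (h3) (h4),
      S.add x (S.add x' x'' h2) h3 = S.add (S.add x x' h1) x'' h4
end TwoCellData

structure HorizontalComp {C : Type u} [Category.{v} C] (S : TwoCellData C) where
  hcomp : ∀ {A B B' : C}, S.H B B' → S.H A B → S.H A B'
  dm_hcomp : ∀ {A B B' : C} (x : S.H B B') (y : S.H A B),
      S.dm (hcomp x y) = S.dm y ≫ S.dm x
  cd_hcomp : ∀ {A B B' : C} (x : S.H B B') (y : S.H A B),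
      S.cd (hcomp x y) = S.cd y ≫ S.cd x
  hcomp_zero_left : ∀ {A B B' : C} (g : B ⟶ B') (y : S.H A B),
      hcomp (S.zero g) y = S.actL g y
  hcomp_zero_right : ∀ {A B B' : C} (x : S.H B B') (f : A ⟶ B),
      hcomp x (S.zero f) = S.actR x f
  hcomp_assoc : ∀ {A B B' B'' : C} (x : S.H B' B'') (y : S.H B B') (z : S.H A B),
      hcomp x (hcomp y z) = hcomp (hcomp x y) z
  interchange : ∀ {A B B' : C} (x x' : S.H B B') (y y' : S.H A B)
      (hx : S.dm x = S.cd x') (hy : S.dm y = S.cd y')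
      (hxy : S.dm (hcomp x y) = S.cd (hcomp x' y')),
      hcomp (S.add x x' hx) (S.add y y' hy) = S.add (hcomp x y) (hcomp x' y') hxy

variable {C : Type u} [Category.{v} C]

/-- The 2-cell data obtained from an extension `map : Cᵒᵖ × C ⥤ Mon` of the
hom functor (`ι : hom(A,B) ⊆ U map(A,B)` naturally), a functor
`K : Cᵒᵖ × C ⥤ Mon` and a natural transformation `D : K ⟶ map`:
`H(A,B) = {(x,f) | D(x) + f ∈ hom(A,B)}`, with a 2-cell `(x,f)` going from
`f` to `D(x) + f`, vertical composition `(x', D(x)+f) + (x,f) = (x'+x, f)`,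
identities `(0,f)` and actions `g(x,f)h = (gxh, gfh)`. -/
noncomputable def derData (mp K : Cᵒᵖ × C ⥤ AddMonCat.{v})
    (ι : ∀ {A B : C}, (A ⟶ B) → mp.obj (op A, B))
    (D : ∀ {A B : C}, K.obj (op A, B) → mp.obj (op A, B))
    (hιnatL : ∀ {A B B' : C} (g : B ⟶ B') (φ : A ⟶ B),
        mp.map (((𝟙 (op A), g) : (op A, B) ⟶ (op A, B'))) (ι φ) = ι (φ ≫ g))
    (hιnatR : ∀ {A' A B : C} (f : A' ⟶ A) (φ : A ⟶ B),
        mp.map (((f.op, 𝟙 B) : (op A, B) ⟶ (op A', B))) (ι φ) = ι (f ≫ φ))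
    (hDnatL : ∀ {A B B' : C} (g : B ⟶ B') (x : K.obj (op A, B)),
        mp.map (((𝟙 (op A), g) : (op A, B) ⟶ (op A, B'))) (D x)
          = D (K.map (((𝟙 (op A), g) : (op A, B) ⟶ (op A, B'))) x))
    (hDnatR : ∀ {A' A B : C} (f : A' ⟶ A) (x : K.obj (op A, B)),
        mp.map (((f.op, 𝟙 B) : (op A, B) ⟶ (op A', B))) (D x)
          = D (K.map (((f.op, 𝟙 B) : (op A, B) ⟶ (op A', B))) x))
    (hD0 : ∀ {A B : C}, D (0 : K.obj (op A, B)) = 0)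
    (hDadd : ∀ {A B : C} (x x' : K.obj (op A, B)), D (x + x') = D x + D x') :
    TwoCellData C where
  H A B := {p : K.obj (op A, B) × (A ⟶ B) // ∃ g : A ⟶ B, ι g = D p.1 + ι p.2}
  dm p := p.1.2
  cd p := p.2.choose
  add x x' h :=
    ⟨(x.1.1 + x'.1.1, x'.1.2),
      ⟨x.2.choose, by
        have h' : x.1.2 = x'.2.choose := h
        calc ι x.2.choose = D x.1.1 + ι x.1.2 := x.2.choose_spec
          _ = D x.1.1 + ι x'.2.choose := by rw [h']
          _ = D x.1.1 + (D x'.1.1 + ι x'.1.2) := by rw [x'.2.choose_spec]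
          _ = D x.1.1 + D x'.1.1 + ι x'.1.2 := (add_assoc _ _ _).symm
          _ = D (x.1.1 + x'.1.1) + ι x'.1.2 := by rw [hDadd]⟩⟩
  zero f := ⟨(0, f), ⟨f, by rw [hD0, zero_add]⟩⟩
  actL := fun {A B B'} g x =>
    ⟨(K.map (((𝟙 (op A), g) : (op A, B) ⟶ (op A, B'))) x.1.1, x.1.2 ≫ g),
      ⟨x.2.choose ≫ g, by
        rw [← hιnatL g x.2.choose, x.2.choose_spec, map_add, hDnatL, hιnatL]⟩⟩
  actR := fun {A' A B} x f =>
    ⟨(K.map (((f.op, 𝟙 B) : (op A, B) ⟶ (op A', B))) x.1.1, f ≫ x.1.2),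
      ⟨f ≫ x.2.choose, by
        rw [← hιnatR f x.2.choose, x.2.choose_spec, map_add, hDnatR, hιnatR]⟩⟩

namespace TwoCellData

theorem add_congr (S : TwoCellData C) {A B : C} {x y x' y' : S.H A B} (hx : x = y)
    (hx' : x' = y') (h : S.dm x = S.cd x') (h' : S.dm y = S.cd y') :
    S.add x x' h = S.add y y' h' := by
  subst hx hx'
  rfl

namespace Lawful

variable {S : TwoCellData C}

theorem dm_actR_cd (hS : S.Lawful) {A B B' : C} (x : S.H B B') (y : S.H A B) :
    S.dm (S.actR x (S.cd y)) = S.cd (S.actL (S.dm x) y) := by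
  rw [hS.dm_actR, hS.cd_actL]

theorem dm_actL_cd (hS : S.Lawful) {A B B' : C} (x : S.H B B') (y : S.H A B) :
    S.dm (S.actL (S.cd x) y) = S.cd (S.actR x (S.dm y)) := by
  rw [hS.dm_actL, hS.cd_actR]

theorem zero_add_of_eq (hS : S.Lawful) {A B : C} (f : A ⟶ B) (x : S.H A B)
    (h : S.dm (S.zero f) = S.cd x) :
    S.add (S.zero f) x h = x := by
  obtain rfl : f = S.cd x := by rw [← h, hS.dm_zero]
  exact hS.zero_add x h

theorem add_zero_of_eq (hS : S.Lawful) {A B : C} (x : S.H A B) (f : A ⟶ B)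
    (h : S.dm x = S.cd (S.zero f)) :
    S.add x (S.zero f) h = x := by
  obtain rfl : f = S.dm x := by rw [h, hS.cd_zero]
  exact hS.add_zero x h

/-- A lawful 2-cell structure satisfying the naturality condition
`cod(x)y + x·dom(y) = x·cod(y) + dom(x)y` is a 2-category. -/
theorem nonempty_horizontalComp (hS : S.Lawful)
    (hnat : ∀ {A B B' : C} (x : S.H B B') (y : S.H A B),
      S.add (S.actL (S.cd x) y) (S.actR x (S.dm y)) (hS.dm_actL_cd x y) =
        S.add (S.actR x (S.cd y)) (S.actL (S.dm x) y) (hS.dm_actR_cd x y)) :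
    Nonempty (HorizontalComp S) := by
  refine ⟨{
    hcomp := fun x y => S.add (S.actR x (S.cd y)) (S.actL (S.dm x) y) (hS.dm_actR_cd x y)
    dm_hcomp := fun x y => by rw [hS.dm_add, hS.dm_actL]
    cd_hcomp := fun x y => by rw [hS.cd_add, hS.cd_actR]
    hcomp_zero_left := fun g y => ?_
    hcomp_zero_right := fun x f => ?_
    hcomp_assoc := fun x y z => ?_
    interchange := fun x x' y y' hx hy hxy => ?_ }⟩
  · simp only [hS.actR_zero, hS.dm_zero]
    exact hS.zero_add_of_eq _ _ _
  · simp only [hS.actL_zero, hS.cd_zero]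
    exact hS.add_zero_of_eq _ _ _
  · have hxy : S.dm (S.actR (S.actR x (S.cd y)) (S.cd z)) =
        S.cd (S.actR (S.actL (S.dm x) y) (S.cd z)) := by
      simp only [hS.dm_actR, hS.cd_actR, hS.cd_actL]
    have hyz : S.dm (S.actR (S.actL (S.dm x) y) (S.cd z)) =
        S.cd (S.actL (S.dm y ≫ S.dm x) z) := by
      simp only [hS.dm_actR, hS.dm_actL, hS.cd_actL]
    calc _ = S.add (S.actR (S.actR x (S.cd y)) (S.cd z))
          (S.add (S.actR (S.actL (S.dm x) y) (S.cd z)) (S.actL (S.dm y ≫ S.dm x) z) hyz)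
          (by rw [hS.cd_add, hxy]) := by
          refine S.add_congr ?_ ?_ _ _
          · rw [hS.cd_add, hS.cd_actR, hS.actR_actR]
          · rw [hS.actL_add _ _ _ _ (by simp only [hS.dm_actL, hS.dm_actR, hS.cd_actL])]
            exact S.add_congr (hS.actL_actR _ _ _) (hS.actL_actL _ _ _) _ _
      _ = _ := hS.add_assoc _ _ _ hxy hyz _ (by rw [hS.dm_add, hyz])
      _ = _ := by
          refine S.add_congr ?_ ?_ _ _
          · rw [hS.actR_add]
          · rw [hS.dm_add, hS.dm_actL]
  · have hxx' : S.dm (S.actR x (S.cd y)) = S.cd (S.actR x' (S.cd y)) := by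
      rw [hS.dm_actR, hS.cd_actR, hx]
    have hyy' : S.dm (S.actL (S.dm x') y) = S.cd (S.actL (S.dm x') y') := by
      rw [hS.dm_actL, hS.cd_actL, hy]
    have hmid : S.dm (S.actL (S.dm x) y) = S.cd (S.actR x' (S.cd y')) := by
      rw [hS.dm_actL, hS.cd_actR, hx, hy]
    have hnat' : S.add (S.actR x' (S.cd y)) (S.actL (S.dm x') y) (hS.dm_actR_cd x' y) =
        S.add (S.actL (S.dm x) y) (S.actR x' (S.cd y')) hmid :=
      (hnat x' y).symm.trans (S.add_congr (by rw [hx]) (by rw [hy]) _ _)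
    calc _ = S.add (S.add (S.actR x (S.cd y)) (S.actR x' (S.cd y)) hxx')
          (S.add (S.actL (S.dm x') y) (S.actL (S.dm x') y') hyy')
          (by rw [hS.dm_add, hS.cd_add, hS.dm_actR_cd]) := by
          refine S.add_congr ?_ ?_ _ _
          · rw [← hS.actR_add x x' hx, hS.cd_add]
          · rw [← hS.actL_add y y' hy, hS.dm_add]
      _ = S.add (S.actR x (S.cd y)) (S.add (S.actR x' (S.cd y))
            (S.add (S.actL (S.dm x') y) (S.actL (S.dm x') y') hyy')
            (by rw [hS.cd_add, hS.dm_actR_cd])) (by rw [hS.cd_add, hxx']) :=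
          (hS.add_assoc _ _ _ _ _ _ _).symm
      _ = S.add (S.actR x (S.cd y)) (S.add
            (S.add (S.actR x' (S.cd y)) (S.actL (S.dm x') y) (hS.dm_actR_cd x' y))
            (S.actL (S.dm x') y') (by rw [hS.dm_add, hyy']))
            (by rw [hS.cd_add, hS.cd_add, hxx']) :=
          S.add_congr rfl (hS.add_assoc _ _ _ _ _ _ _) _ _
      _ = S.add (S.actR x (S.cd y)) (S.add
            (S.add (S.actL (S.dm x) y) (S.actR x' (S.cd y')) hmid)
            (S.actL (S.dm x') y') (by rw [hS.dm_add, hS.dm_actR_cd]))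
            (by rw [hS.cd_add, hS.cd_add, hS.dm_actR_cd]) :=
          S.add_congr rfl (S.add_congr hnat' rfl _ _) _ _
      _ = S.add (S.actR x (S.cd y)) (S.add (S.actL (S.dm x) y)
            (S.add (S.actR x' (S.cd y')) (S.actL (S.dm x') y') (hS.dm_actR_cd x' y'))
            (by rw [hS.cd_add, hmid])) (by rw [hS.cd_add, hS.dm_actR_cd]) :=
          S.add_congr rfl (hS.add_assoc _ _ _ _ _ _ _).symm _ _
      _ = _ := hS.add_assoc _ _ _ _ _ _ _

end Lawful

end TwoCellData

theorem map_prod_map_apply (K : Cᵒᵖ × C ⥤ AddMonCat.{v}) {X Y Z : Cᵒᵖ} {X' Y' Z' : C}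
    (p : X ⟶ Y) (p' : X' ⟶ Y') (q : Y ⟶ Z) (q' : Y' ⟶ Z') (x : K.obj (X, X')) :
    K.map ((q, q') : (Y, Y') ⟶ (Z, Z')) (K.map ((p, p') : (X, X') ⟶ (Y, Y')) x) =
      K.map ((p ≫ q, p' ≫ q') : (X, X') ⟶ (Z, Z')) x := by
  rw [← ConcreteCategory.comp_apply, ← K.map_comp]
  rfl

theorem map_prod_id_apply (K : Cᵒᵖ × C ⥤ AddMonCat.{v}) {X : Cᵒᵖ × C}
    (x : K.obj X) : K.map (𝟙 X.1, 𝟙 X.2) x = x := by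
  rw [show ((𝟙 X.1, 𝟙 X.2) : X ⟶ X) = 𝟙 X from rfl]
  simp

/-- Under the hypotheses above (with `ι` injective, i.e.
`hom(A,B) ⊆ U map(A,B)`), the data `derData` is a (lawful) 2-cell structure on
`C`; and if in addition `D(y)x + gx + yf = yD(x) + yf + gx` (expressed via the
codomains `g'`, `f''` of the 2-cells `(y,g)`, `(x,f)`), then the resulting
structure is a 2-category. -/
theorem derData_lawful_and_twoCategory (mp K : Cᵒᵖ × C ⥤ AddMonCat.{v})
    (ι : ∀ {A B : C}, (A ⟶ B) → mp.obj (op A, B))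
    (D : ∀ {A B : C}, K.obj (op A, B) → mp.obj (op A, B))
    (hιinj : ∀ {A B : C}, Function.Injective (ι : (A ⟶ B) → mp.obj (op A, B)))
    (hιnatL : ∀ {A B B' : C} (g : B ⟶ B') (φ : A ⟶ B),
        mp.map (((𝟙 (op A), g) : (op A, B) ⟶ (op A, B'))) (ι φ) = ι (φ ≫ g))
    (hιnatR : ∀ {A' A B : C} (f : A' ⟶ A) (φ : A ⟶ B),
        mp.map (((f.op, 𝟙 B) : (op A, B) ⟶ (op A', B))) (ι φ) = ι (f ≫ φ))
    (hDnatL : ∀ {A B B' : C} (g : B ⟶ B') (x : K.obj (op A, B)),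
        mp.map (((𝟙 (op A), g) : (op A, B) ⟶ (op A, B'))) (D x)
          = D (K.map (((𝟙 (op A), g) : (op A, B) ⟶ (op A, B'))) x))
    (hDnatR : ∀ {A' A B : C} (f : A' ⟶ A) (x : K.obj (op A, B)),
        mp.map (((f.op, 𝟙 B) : (op A, B) ⟶ (op A', B))) (D x)
          = D (K.map (((f.op, 𝟙 B) : (op A, B) ⟶ (op A', B))) x))
    (hD0 : ∀ {A B : C}, D (0 : K.obj (op A, B)) = 0)
    (hDadd : ∀ {A B : C} (x x' : K.obj (op A, B)), D (x + x') = D x + D x') :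
    (derData mp K @ι @D @hιnatL @hιnatR @hDnatL @hDnatR @hD0 @hDadd).Lawful ∧
    ((∀ {A B B' : C} (x : K.obj (op A, B)) (f : A ⟶ B)
        (y : K.obj (op B, B')) (g : B ⟶ B') (g' : B ⟶ B') (f'' : A ⟶ B),
        ι g' = D y + ι g → ι f'' = D x + ι f →
        K.map (((𝟙 (op A), g') : (op A, B) ⟶ (op A, B'))) x
            + K.map (((f.op, 𝟙 B') : (op B, B') ⟶ (op A, B'))) y
          = K.map (((f''.op, 𝟙 B') : (op B, B') ⟶ (op A, B'))) y
            + K.map (((𝟙 (op A), g) : (op A, B) ⟶ (op A, B'))) x) →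
      Nonempty (HorizontalComp
        (derData mp K @ι @D @hιnatL @hιnatR @hDnatL @hDnatR @hD0 @hDadd))) := by
  set S := derData mp K @ι @D @hιnatL @hιnatR @hDnatL @hDnatR @hD0 @hDadd
  have hspec : ∀ {A B : C} (p : S.H A B), ι (S.cd p) = D p.1.1 + ι p.1.2 :=
    fun p => p.2.choose_spec
  have hcd : ∀ {A B : C} (p : S.H A B) (g : A ⟶ B), ι g = D p.1.1 + ι p.1.2 → S.cd p = g :=
    fun p g h => hιinj ((hspec p).trans h.symm)
  have hS : S.Lawful :=
    { dm_actL := fun g y => rfl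
      dm_actR := fun x f => rfl
      cd_actL := fun g y => hcd _ _ (by
        rw [← hιnatL, hspec, map_add, hDnatL, hιnatL]; rfl)
      cd_actR := fun x f => hcd _ _ (by
        rw [← hιnatR, hspec, map_add, hDnatR, hιnatR]; rfl)
      actL_zero := fun g f => Subtype.ext (Prod.ext (map_zero _) rfl)
      actR_zero := fun f h => Subtype.ext (Prod.ext (map_zero _) rfl)
      actR_add := fun x x' h f h2 => Subtype.ext (Prod.ext (map_add _ _ _) rfl)
      actL_add := fun y y' h g h2 => Subtype.ext (Prod.ext (map_add _ _ _) rfl)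
      actL_actL := fun g g' y => Subtype.ext (Prod.ext
        ((map_prod_map_apply K (𝟙 _) g (𝟙 _) g' y.1.1).trans (by rw [Category.id_comp]; rfl))
        (Category.assoc _ _ _))
      actR_actR := fun x f f' => Subtype.ext (Prod.ext
        ((map_prod_map_apply K f.op (𝟙 _) f'.op (𝟙 _) x.1.1).trans
          (by rw [Category.id_comp]; rfl))
        (Category.assoc _ _ _).symm)
      actL_actR := fun g x f => Subtype.ext (Prod.ext
        ((map_prod_map_apply K f.op (𝟙 _) (𝟙 _) g x.1.1).trans
          (Eq.trans (by simp only [Category.id_comp, Category.comp_id])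
            (map_prod_map_apply K (𝟙 _) g f.op (𝟙 _) x.1.1).symm))
        (Category.assoc _ _ _))
      actL_id := fun x => Subtype.ext (Prod.ext (map_prod_id_apply K _) (Category.comp_id _))
      actR_id := fun x => Subtype.ext (Prod.ext (map_prod_id_apply K _) (Category.id_comp _))
      dm_zero := fun f => rfl
      cd_zero := fun f => hcd _ _ (by
        change ι f = D 0 + ι f
        rw [hD0, zero_add])
      dm_add := fun x x' h => rfl
      cd_add := fun x x' h => hcd _ _ (by
        change ι (S.cd x) = D (x.1.1 + x'.1.1) + ι x'.1.2
        rw [hspec, hDadd, add_assoc, ← hspec x', ← h]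
        rfl)
      zero_add := fun x h => Subtype.ext (Prod.ext (zero_add _) rfl)
      add_zero := fun x h => Subtype.ext (Prod.ext (add_zero _) rfl)
      add_assoc := fun x x' x'' h1 h2 h3 h4 =>
        Subtype.ext (Prod.ext (add_assoc _ _ _).symm rfl) }
  refine ⟨hS, fun hcomm => hS.nonempty_horizontalComp fun x y => ?_⟩
  exact Subtype.ext (Prod.ext
    (hcomm y.1.1 y.1.2 x.1.1 x.1.2 (S.cd x) (S.cd y) (hspec x) (hspec y)) rfl)
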